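/- Let T be a rooted tree on n vertices, let k ≥ 1 be an integer, and let M ⊆ V(T). Let X ⊆ V(T) be a set of vertices such that: (i) every x ∈ X satisfies |T(x)| ≥ k, and (ii) for any x1, x2 ∈ X such that x1 is a proper ancestor of x2, the unique path in T from x1 to x2 contains a vertex of M. Then k · |X| ≤ 2n + 2k·|M|, i.e., |X| ≤ 2n/k + 2|M|. -/

import Mathlib

/-- In a rooted tree `T` with root `r`, a vertex `u` is an ancestor of `v` if `u`
lies on the (unique) path from `r` to `v`. -/
def IsAncestor {V : Type*} (T : SimpleGraph V) (r u v : V) : Prop :=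
  ∀ p : T.Path r v, u ∈ p.val.support

/-- The subtree `T(x)`: the set of all descendants of `x` (including `x`). -/
def Subtree {V : Type*} (T : SimpleGraph V) (r x : V) : Set V :=
  {v | IsAncestor T r x v}

theorem hss_uniq {V : Type*} {T : SimpleGraph V} (hT : T.IsTree) {u v : V}
    {p q : T.Walk u v} (hp : p.IsPath) (hq : q.IsPath) : p = q :=
  (hT.existsUnique_path u v).unique hp hq

theorem hss_len {V : Type*} {T : SimpleGraph V} (hT : T.IsTree) {u v : V}
    {p : T.Walk u v} (hp : p.IsPath) : p.length = T.dist u v := by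
  obtain ⟨q, hq, hl⟩ := hT.connected.exists_path_of_dist u v
  rw [hss_uniq hT hp hq, hl]

theorem hss_mk {V : Type*} {T : SimpleGraph V} (hT : T.IsTree) {r u v : V}
    (a : T.Walk r u) (b : T.Walk u v) (h : (a.append b).IsPath) : IsAncestor T r u v := by
  intro p
  rw [hss_uniq hT p.2 h, SimpleGraph.Walk.mem_support_append_iff]
  exact Or.inl a.end_mem_support

theorem hss_split {V : Type*} {T : SimpleGraph V} (hT : T.IsTree) {r u v : V}
    (h : IsAncestor T r u v) : ∃ (a : T.Walk r u) (b : T.Walk u v), (a.append b).IsPath := by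
  obtain ⟨p, hp, -⟩ := hT.existsUnique_path r v
  obtain ⟨a, b, rfl⟩ := SimpleGraph.Walk.mem_support_iff_exists_append.1 (h ⟨p, hp⟩)
  exact ⟨a, b, hp⟩

theorem hss_total {V : Type*} {T : SimpleGraph V} (hT : T.IsTree) {r x y v : V}
    (hx : IsAncestor T r x v) (hy : IsAncestor T r y v) :
    IsAncestor T r x y ∨ IsAncestor T r y x := by
  obtain ⟨a, b, hab⟩ := hss_split hT hx
  have h := hy ⟨_, hab⟩
  rcases (SimpleGraph.Walk.mem_support_append_iff _ _).1 h with h | h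
  · obtain ⟨c, d, rfl⟩ := SimpleGraph.Walk.mem_support_iff_exists_append.1 h
    exact Or.inr (hss_mk hT c d hab.of_append_left)
  · obtain ⟨c, d, rfl⟩ := SimpleGraph.Walk.mem_support_iff_exists_append.1 h
    rw [SimpleGraph.Walk.append_assoc] at hab
    exact Or.inl (hss_mk hT a c hab.of_append_left)

theorem hss_dist {V : Type*} {T : SimpleGraph V} (hT : T.IsTree) {r x y : V}
    (hx : IsAncestor T r x y) : T.dist r x ≤ T.dist r y := by
  obtain ⟨a, b, hab⟩ := hss_split hT hx
  rw [← hss_len hT hab, ← hss_len hT hab.of_append_left, SimpleGraph.Walk.length_append]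
  omega

theorem hss_between {V : Type*} {T : SimpleGraph V} (hT : T.IsTree) {r x y w : V}
    (hx : IsAncestor T r x y) (p : T.Path x y) (hw : w ∈ p.val.support) :
    IsAncestor T r x w ∧ (w ≠ y → T.dist r w < T.dist r y) := by
  obtain ⟨a, b, hab⟩ := hss_split hT hx
  rw [hss_uniq hT p.2 hab.of_append_right] at hw
  obtain ⟨c, d, rfl⟩ := SimpleGraph.Walk.mem_support_iff_exists_append.1 hw
  rw [SimpleGraph.Walk.append_assoc] at hab
  refine ⟨hss_mk hT a c hab.of_append_left, fun hne => ?_⟩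
  rw [← hss_len hT hab, ← hss_len hT hab.of_append_left, SimpleGraph.Walk.length_append _ d]
  have : d.length ≠ 0 := fun h => hne (SimpleGraph.Walk.eq_of_length_eq_zero h)
  omega

/-- Let `T` be a rooted tree on `n` vertices, `k ≥ 1`, and `M` a set of vertices.
If `X` is a set of vertices such that (i) every `x ∈ X` has `|T(x)| ≥ k`, and
(ii) for any `x₁, x₂ ∈ X` with `x₁` a proper ancestor of `x₂`, the path from `x₁`
to `x₂` contains a vertex of `M`, then `k·|X| ≤ 2n + 2k·|M|`. -/
theorem heavy_separated_subtrees_bound {V : Type*} [Fintype V]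
    (T : SimpleGraph V) (r : V) (hT : T.IsTree) (k : ℕ) (hk : 1 ≤ k)
    (M X : Set V)
    (hheavy : ∀ x ∈ X, k ≤ (Subtree T r x).ncard)
    (hsep : ∀ x₁ ∈ X, ∀ x₂ ∈ X, x₁ ≠ x₂ → IsAncestor T r x₁ x₂ →
      ∀ p : T.Path x₁ x₂, ∃ w ∈ p.val.support, w ∈ M) :
    k * X.ncard ≤ 2 * Fintype.card V + 2 * (k * M.ncard) := by
  classical
  have hpath : ∀ u v : V, Nonempty (T.Path u v) := fun u v => by
    obtain ⟨p, hp, -⟩ := hT.existsUnique_path u v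
    exact ⟨⟨p, hp⟩⟩
  -- the lowest elements of `X`
  let L : Set V := {x | x ∈ X ∧ ∀ y ∈ X, x ≠ y → ¬ IsAncestor T r x y}
  let N : Set V := {x | x ∈ X ∧ x ∉ M ∧ ∃ y ∈ X, x ≠ y ∧ IsAncestor T r x y}
  have hcov : X ⊆ L ∪ (M ∪ N) := by
    intro x hx
    by_cases hl : x ∈ L
    · exact Or.inl hl
    · by_cases hm : x ∈ M
      · exact Or.inr (Or.inl hm)
      · refine Or.inr (Or.inr ⟨hx, hm, ?_⟩)
        by_contra hcon
        exact hl ⟨hx, fun y hy hne ha => hcon ⟨y, hy, hne, ha⟩⟩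
  have hL : k * L.ncard ≤ Fintype.card V := by
    have hdisj : ∀ x ∈ L.toFinset, ∀ y ∈ L.toFinset, x ≠ y →
        Disjoint (Subtree T r x).toFinset (Subtree T r y).toFinset := by
      intro x hx y hy hne
      rw [Set.mem_toFinset] at hx hy
      rw [Set.disjoint_toFinset, Set.disjoint_left]
      intro v hvx hvy
      rcases hss_total hT hvx hvy with h | h
      · exact hx.2 y hy.1 hne h
      · exact hy.2 x hx.1 hne.symm h
    calc k * L.ncard = ∑ x ∈ L.toFinset, k := by
          rw [Finset.sum_const, smul_eq_mul, mul_comm, Set.ncard_eq_toFinset_card']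
      _ ≤ ∑ x ∈ L.toFinset, (Subtree T r x).toFinset.card := by
          refine Finset.sum_le_sum fun x hx => ?_
          rw [← Set.ncard_eq_toFinset_card']
          exact hheavy x (Set.mem_toFinset.1 hx).1
      _ = (L.toFinset.biUnion fun x => (Subtree T r x).toFinset).card :=
          (Finset.card_biUnion hdisj).symm
      _ ≤ Fintype.card V := Finset.card_le_univ _
  have hex : ∀ x : V, x ∈ N → ∃ m, (m ∈ M ∧ IsAncestor T r x m) ∧
      ∀ m', m' ∈ M ∧ IsAncestor T r x m' → T.dist r m ≤ T.dist r m' := by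
    rintro x ⟨hx, -, y, hy, hne, ha⟩
    obtain ⟨p⟩ := hpath x y
    obtain ⟨w, hw, hwM⟩ := hsep x hx y hy hne ha p
    exact Set.exists_min_image {m | m ∈ M ∧ IsAncestor T r x m} (T.dist r) (Set.toFinite _)
      ⟨w, hwM, (hss_between hT ha p hw).1⟩
  choose! f hf hmin using hex
  have key : ∀ x ∈ N, ∀ y ∈ N, f x = f y → IsAncestor T r x y → x = y := by
    intro x hx y hy hxy ha
    by_contra hne
    obtain ⟨p⟩ := hpath x y
    obtain ⟨w, hw, hwM⟩ := hsep x hx.1 y hy.1 hne ha p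
    obtain ⟨h1, h2⟩ := hss_between hT ha p hw
    have h3 := h2 (fun h => hy.2.1 (h ▸ hwM))
    have h4 := hmin x hx w ⟨hwM, h1⟩
    have h5 := hss_dist hT (hf y hy).2
    rw [hxy] at h4
    omega
  have hN : N.ncard ≤ M.ncard := by
    refine Set.ncard_le_ncard_of_injOn f (fun x hx => (hf x hx).1) ?_ (Set.toFinite _)
    intro x hx y hy hxy
    have h2 := (hf y hy).2
    rw [← hxy] at h2
    rcases hss_total hT (hf x hx).2 h2 with h | h
    · exact key x hx y hy hxy h
    · exact (key y hy x hx hxy.symm h).symm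
  have h1 : X.ncard ≤ L.ncard + (M.ncard + N.ncard) :=
    (Set.ncard_le_ncard hcov (Set.toFinite _)).trans
      ((Set.ncard_union_le _ _).trans (Nat.add_le_add_left (Set.ncard_union_le _ _) _))
  have h2 : X.ncard ≤ L.ncard + 2 * M.ncard := by omega
  have h3 := Nat.mul_le_mul_left k h2
  have h4 : k * (L.ncard + 2 * M.ncard) = k * L.ncard + 2 * (k * M.ncard) := by ring
  omega
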